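/- For all x ∈ A, writing Δ^{(2)}(x) = x_{(1)} ⊗ x_{(2)} ⊗ x_{(3)}: ⟨ω, g^{1/2} x_{(2)} g^{1/2} J(x_{(3)})⟩ x_{(1)} = x, and ⟨ω, g^{-1/2} J(x_{(1)}) g^{-1/2} x_{(2)}⟩ x_{(3)} = x. -/

import Mathlib

open scoped TensorProduct

noncomputable section

/-- An element of a `C*`-algebra is positive iff it is of the form `star y * y`. -/
def IsPosElem {A : Type*} [Mul A] [Star A] (x : A) : Prop := ∃ y : A, x = star y * y

section Helpers

variable {A : Type*} [NormedRing A] [StarRing A] [CStarRing A]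
  [NormedAlgebra ℂ A] [StarModule ℂ A]

/-- Apply a linear functional to the first leg of a tensor (`⟨φ, u₁⟩ u₂`). -/
def lapp (φ : A →ₗ[ℂ] ℂ) : A ⊗[ℂ] A →ₗ[ℂ] A :=
  (TensorProduct.lid ℂ A).toLinearMap ∘ₗ TensorProduct.map φ LinearMap.id

/-- Apply a linear functional to the second leg of a tensor (`⟨φ, u₂⟩ u₁`). -/
def rapp (φ : A →ₗ[ℂ] ℂ) : A ⊗[ℂ] A →ₗ[ℂ] A :=
  (TensorProduct.rid ℂ A).toLinearMap ∘ₗ TensorProduct.map LinearMap.id φ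

/-- Apply a pair of linear functionals to the two legs of a tensor (`⟨φ, u₁⟩⟨ψ, u₂⟩`). -/
def papp (φ ψ : A →ₗ[ℂ] ℂ) : A ⊗[ℂ] A →ₗ[ℂ] ℂ :=
  (TensorProduct.lid ℂ ℂ).toLinearMap ∘ₗ TensorProduct.map φ ψ

end Helpers

/-- A `C*`-weak Hopf algebra: a finite-dimensional unital `C*`-algebra `A` equipped with a
comultiplication `Δ` (written in Sweedler notation `Δ x = x₍₁₎ ⊗ x₍₂₎`), counit `ε` and
antipode `S`, satisfying the axioms of Böhm–Szlachányi.  The field `starT` is the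
(componentwise) star operation on `A ⊗[ℂ] A`, characterized by additivity and its values on
pure tensors. -/
structure WeakHopfData (A : Type*) [NormedRing A] [StarRing A] [CStarRing A]
    [NormedAlgebra ℂ A] [StarModule ℂ A] [FiniteDimensional ℂ A] : Type _ where
  Δ : A →ₗ[ℂ] A ⊗[ℂ] A
  ε : A →ₗ[ℂ] ℂ
  S : A ≃ₗ[ℂ] A
  starT : A ⊗[ℂ] A → A ⊗[ℂ] A
  starT_add : ∀ u v : A ⊗[ℂ] A, starT (u + v) = starT u + starT v
  starT_tmul : ∀ a b : A, starT (a ⊗ₜ[ℂ] b) = star a ⊗ₜ[ℂ] star b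
  /-- coassociativity of the comultiplication -/
  coassoc : (TensorProduct.assoc ℂ A A A).toLinearMap ∘ₗ
      (TensorProduct.map Δ LinearMap.id) ∘ₗ Δ = (TensorProduct.map LinearMap.id Δ) ∘ₗ Δ
  /-- counit axiom, left version -/
  counit_left : (TensorProduct.lid ℂ A).toLinearMap ∘ₗ (TensorProduct.map ε LinearMap.id) ∘ₗ Δ
      = LinearMap.id
  /-- counit axiom, right version -/
  counit_right : (TensorProduct.rid ℂ A).toLinearMap ∘ₗ (TensorProduct.map LinearMap.id ε) ∘ₗ Δ
      = LinearMap.id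
  /-- the comultiplication is multiplicative -/
  Δ_mul : ∀ x y : A, Δ (x * y) = Δ x * Δ y
  /-- the star operation is comultiplicative -/
  Δ_star : ∀ x : A, Δ (star x) = starT (Δ x)
  /-- the unit is weakly comultiplicative:
  `(Δ ⊗ id)(Δ 1) = (Δ 1 ⊗ 1)(1 ⊗ Δ 1)` -/
  Δ_one_weak : (TensorProduct.map Δ LinearMap.id) (Δ 1)
      = (Δ 1 ⊗ₜ[ℂ] (1 : A)) * ((TensorProduct.assoc ℂ A A A).symm ((1 : A) ⊗ₜ[ℂ] Δ 1))
  /-- the unit is weakly comultiplicative: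
  `(Δ ⊗ id)(Δ 1) = (1 ⊗ Δ 1)(Δ 1 ⊗ 1)` -/
  Δ_one_weak' : (TensorProduct.map Δ LinearMap.id) (Δ 1)
      = ((TensorProduct.assoc ℂ A A A).symm ((1 : A) ⊗ₜ[ℂ] Δ 1)) * (Δ 1 ⊗ₜ[ℂ] (1 : A))
  /-- the counit is weakly multiplicative: `ε (x y z) = ε (x y₍₁₎) ε (y₍₂₎ z)` -/
  ε_weak : ∀ x y z : A,
      ε (x * y * z) = papp (ε ∘ₗ LinearMap.mulLeft ℂ x) (ε ∘ₗ LinearMap.mulRight ℂ z) (Δ y)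
  /-- the counit is weakly multiplicative: `ε (x y z) = ε (x y₍₂₎) ε (y₍₁₎ z)` -/
  ε_weak' : ∀ x y z : A,
      ε (x * y * z) = papp (ε ∘ₗ LinearMap.mulRight ℂ z) (ε ∘ₗ LinearMap.mulLeft ℂ x) (Δ y)
  /-- antipode axiom: `x₍₁₎ S(x₍₂₎) = ε (1₍₁₎ x) 1₍₂₎` -/
  antipode_left : ∀ x : A,
      LinearMap.mul' ℂ A ((TensorProduct.map LinearMap.id S.toLinearMap) (Δ x))
        = lapp (ε ∘ₗ LinearMap.mulRight ℂ x) (Δ 1)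
  /-- antipode axiom: `S(x₍₁₎) x₍₂₎ = 1₍₁₎ ε (x 1₍₂₎)` -/
  antipode_right : ∀ x : A,
      LinearMap.mul' ℂ A ((TensorProduct.map S.toLinearMap LinearMap.id) (Δ x))
        = rapp (ε ∘ₗ LinearMap.mulLeft ℂ x) (Δ 1)
  /-- the antipode is antimultiplicative -/
  S_antimul : ∀ x y : A, S (x * y) = S y * S x
  /-- the antipode is anticomultiplicative -/
  S_anticomul : ∀ x : A,
      Δ (S x) = (TensorProduct.comm ℂ A A) ((TensorProduct.map S.toLinearMap S.toLinearMap) (Δ x))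

namespace WeakHopfData

variable {A : Type*} [NormedRing A] [StarRing A] [CStarRing A]
  [NormedAlgebra ℂ A] [StarModule ℂ A] [FiniteDimensional ℂ A]

/-- The source counital map `ε^L (x) = x₍₁₎ S(x₍₂₎)`. -/
def εL (W : WeakHopfData A) : A →ₗ[ℂ] A :=
  LinearMap.mul' ℂ A ∘ₗ TensorProduct.map LinearMap.id W.S.toLinearMap ∘ₗ W.Δ

/-- The target counital map `ε^R (x) = S(x₍₁₎) x₍₂₎`. -/
def εR (W : WeakHopfData A) : A →ₗ[ℂ] A :=
  LinearMap.mul' ℂ A ∘ₗ TensorProduct.map W.S.toLinearMap LinearMap.id ∘ₗ W.Δ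

/-- Full contraction of the iterated coproduct `Δ⁽ⁿ⁾ x = x₍₁₎ ⊗ ⋯ ⊗ x₍ₙ₊₁₎` against a family
of `n+1` linear functionals: `sweedlerEval W n φ x = ⟨φ 0, x₍₁₎⟩ ⋯ ⟨φ n, x₍ₙ₊₁₎⟩`.
Since linear functionals separate the points of a tensor power, identities between iterated
coproducts are faithfully expressed through these contractions. -/
def sweedlerEval (W : WeakHopfData A) : (n : ℕ) → (Fin (n + 1) → (A →ₗ[ℂ] ℂ)) → (A →ₗ[ℂ] ℂ)
  | 0, φ => φ 0
  | n + 1, φ => papp (sweedlerEval W n (Fin.init φ)) (φ (Fin.last (n + 1))) ∘ₗ W.Δ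

end WeakHopfData

/-- A `C*`-weak Hopf algebra together with its canonical distinguished elements:
the Haar integral `h`, the dual Haar integral `hHat`, the square roots `gL`, `gR` of
`E^L h`, `E^R h` (whence the canonical grouplike element `g = gL * gR⁻¹`), real powers
`gLpow`, `gRpow` of `gL` and `gR`, and a positive square root operation `sqrt`;
all characterized by the (uniquely determining) properties listed as fields. -/
structure HaarPkg (A : Type*) [NormedRing A] [StarRing A] [CStarRing A]
    [NormedAlgebra ℂ A] [StarModule ℂ A] [FiniteDimensional ℂ A] : Type _ where
  W : WeakHopfData A
  /-- the Haar integral -/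
  h : A
  haar_left : ∀ x : A, x * h = WeakHopfData.εL W x * h
  haar_right : ∀ x : A, h * x = h * WeakHopfData.εR W x
  haar_counitL : WeakHopfData.εL W h = 1
  haar_counitR : WeakHopfData.εR W h = 1
  haar_idem : h * h = h
  haar_star : star h = h
  haar_S : W.S h = h
  haar_nondeg : ∀ y : A, ∃ φ ψ : A →ₗ[ℂ] ℂ, lapp φ (W.Δ h) = y ∧ rapp ψ (W.Δ h) = y
  /-- the Haar integral of the dual weak Hopf algebra `A*`, as a linear functional on `A` -/
  hHat : A →ₗ[ℂ] ℂ
  hHat_pos : ∀ x : A, ∃ r : ℝ, 0 ≤ r ∧ hHat (star x * x) = (r : ℂ)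
  hHat_S : ∀ x : A, hHat (W.S x) = hHat x
  /-- `gL = (E^L h)^{1/2}` -/
  gL : A
  /-- `gR = (E^R h)^{1/2}` -/
  gR : A
  gL_pos : IsPosElem gL
  gR_pos : IsPosElem gR
  gL_unit : IsUnit gL
  gR_unit : IsUnit gR
  gL_sq : gL * gL = rapp hHat (W.Δ h)
  gR_sq : gR * gR = lapp hHat (W.Δ h)
  gL_mem : gL ∈ Set.range (WeakHopfData.εL W)
  gR_mem : gR ∈ Set.range (WeakHopfData.εR W)
  gR_S : gR = W.S gL
  gLR_comm : gL * gR = gR * gL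
  /-- the canonical grouplike element `g = gL * gR⁻¹` is positive -/
  g_pos : IsPosElem (gL * Ring.inverse gR)
  g_unit : IsUnit (gL * Ring.inverse gR)
  /-- `Δ g = (g ⊗ g) Δ 1` -/
  g_grouplike : W.Δ (gL * Ring.inverse gR)
      = ((gL * Ring.inverse gR) ⊗ₜ[ℂ] (gL * Ring.inverse gR)) * W.Δ 1
  /-- `Δ g = Δ 1 (g ⊗ g)` -/
  g_grouplike' : W.Δ (gL * Ring.inverse gR)
      = W.Δ 1 * ((gL * Ring.inverse gR) ⊗ₜ[ℂ] (gL * Ring.inverse gR))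
  /-- `S g = g⁻¹` -/
  g_S : W.S (gL * Ring.inverse gR) = Ring.inverse (gL * Ring.inverse gR)
  /-- `S² x = g x g⁻¹` -/
  S_sq : ∀ x : A,
      W.S (W.S x) = (gL * Ring.inverse gR) * x * Ring.inverse (gL * Ring.inverse gR)
  /-- `h₍₁₎ ⊗ g h₍₂₎ g = h₍₂₎ ⊗ h₍₁₎` -/
  haar_flip : TensorProduct.map LinearMap.id
      (LinearMap.mulLeft ℂ (gL * Ring.inverse gR) ∘ₗ LinearMap.mulRight ℂ (gL * Ring.inverse gR))
      (W.Δ h) = (TensorProduct.comm ℂ A A) (W.Δ h)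
  /-- dual integral relation `⟨ĥ, x (h gL⁻²)⟩ = ε x` -/
  hHat_dual₁ : ∀ x : A, hHat (x * (h * (Ring.inverse gL * Ring.inverse gL))) = W.ε x
  /-- dual integral relation `⟨ĥ, (gR⁻² h) x⟩ = ε x` -/
  hHat_dual₂ : ∀ x : A, hHat ((Ring.inverse gR * Ring.inverse gR * h) * x) = W.ε x
  /-- dual integral relation `⟨ĥ, (h gL⁻²)₍₂₎⟩ (h gL⁻²)₍₁₎ = 1` -/
  hHat_dual₃ : rapp hHat (W.Δ (h * (Ring.inverse gL * Ring.inverse gL))) = 1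
  /-- dual integral relation `⟨ĥ, (gR⁻² h)₍₁₎⟩ (gR⁻² h)₍₂₎ = 1` -/
  hHat_dual₄ : lapp hHat (W.Δ (Ring.inverse gR * Ring.inverse gR * h)) = 1
  /-- the positive square root, via the continuous functional calculus -/
  sqrt : A → A
  sqrt_pos : ∀ x : A, IsPosElem x → IsPosElem (sqrt x)
  sqrt_mul_self : ∀ x : A, IsPosElem x → sqrt x * sqrt x = x
  /-- real powers of `gL`, via the continuous functional calculus -/
  gLpow : ℝ → A
  /-- real powers of `gR`, via the continuous functional calculus -/
  gRpow : ℝ → A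
  gLpow_one : gLpow 1 = gL
  gRpow_one : gRpow 1 = gR
  gLpow_zero : gLpow 0 = 1
  gRpow_zero : gRpow 0 = 1
  gLpow_add : ∀ s t : ℝ, gLpow (s + t) = gLpow s * gLpow t
  gRpow_add : ∀ s t : ℝ, gRpow (s + t) = gRpow s * gRpow t
  gLpow_pos : ∀ t : ℝ, IsPosElem (gLpow t)
  gRpow_pos : ∀ t : ℝ, IsPosElem (gRpow t)
  gLpow_continuous : Continuous gLpow
  gRpow_continuous : Continuous gRpow

namespace HaarPkg

variable {A : Type*} [NormedRing A] [StarRing A] [CStarRing A]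
  [NormedAlgebra ℂ A] [StarModule ℂ A] [FiniteDimensional ℂ A]
variable (P : HaarPkg A)

/-- The canonical grouplike element `g = gL gR⁻¹`. -/
def g : A := P.gL * Ring.inverse P.gR

/-- The Watatani index `ı = ε^L (h gL⁻²)` of the Haar conditional expectations. -/
def iotaEl : A := WeakHopfData.εL P.W (P.h * (Ring.inverse P.gL * Ring.inverse P.gL))

/-- The element `ȷ = ⟨ĥ, (gL⁻²)₍₁₎⟩ (gL⁻²)₍₂₎`, the dual analogue of the Watatani index. -/
def jayEl : A := lapp P.hHat (P.W.Δ (Ring.inverse P.gL * Ring.inverse P.gL))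

/-- The pulling-through element `Ω = ı⁻¹ gL⁻¹ h gL⁻¹`. -/
def Ω : A := Ring.inverse P.iotaEl * Ring.inverse P.gL * P.h * Ring.inverse P.gL

/-- The map `J x = g^{-1/2} S(x) g^{1/2}`, as a linear map. -/
def Jlin : A →ₗ[ℂ] A :=
  LinearMap.mulRight ℂ (P.sqrt P.g) ∘ₗ
    LinearMap.mulLeft ℂ (Ring.inverse (P.sqrt P.g)) ∘ₗ P.W.S.toLinearMap

/-- The functional `⟨ω, x⟩ = ⟨ĥ, ȷ⁻¹ gL⁻¹ gR⁻¹ x⟩` (the dual analogue of `Ω`). -/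
def ω : A →ₗ[ℂ] ℂ :=
  P.hHat ∘ₗ LinearMap.mulLeft ℂ (Ring.inverse P.jayEl * (Ring.inverse P.gL * Ring.inverse P.gR))

/-- `ξ_L = ı^{1/2} ȷ^{1/2} gL`. -/
def ξL : A := P.sqrt P.iotaEl * P.sqrt P.jayEl * P.gL

/-- `ξ_R = ı^{1/2} ȷ^{1/2} gR`. -/
def ξR : A := P.sqrt P.iotaEl * P.sqrt P.jayEl * P.gR

/-- `ξ = ξ_L ξ_R`. -/
def ξ : A := P.ξL * P.ξR

/-- `J^L x = gL⁻¹ S(x) gL`. -/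
def JL : A → A := fun x => Ring.inverse P.gL * P.W.S x * P.gL

/-- `J^R x = gL S⁻¹(x) gL⁻¹`. -/
def JR : A → A := fun x => P.gL * P.W.S.symm x * Ring.inverse P.gL

end HaarPkg

section Stmt16

variable {A : Type*} [NormedRing A] [StarRing A] [CStarRing A]
  [NormedAlgebra ℂ A] [StarModule ℂ A] [FiniteDimensional ℂ A]

/-- The bilinear contraction `(u, v) ↦ ⟨ω, g^{1/2} u g^{1/2} J(v)⟩` on `A ⊗ A`. -/
noncomputable def HaarPkg.contractB (P : HaarPkg A) : A ⊗[ℂ] A →ₗ[ℂ] ℂ :=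
  P.ω ∘ₗ LinearMap.mul' ℂ A ∘ₗ
    TensorProduct.map
      (LinearMap.mulRight ℂ (P.sqrt P.g) ∘ₗ LinearMap.mulLeft ℂ (P.sqrt P.g)) P.Jlin

/-- The bilinear contraction `(u, v) ↦ ⟨ω, g^{-1/2} J(u) g^{-1/2} v⟩` on `A ⊗ A`. -/
noncomputable def HaarPkg.contractC (P : HaarPkg A) : A ⊗[ℂ] A →ₗ[ℂ] ℂ :=
  P.ω ∘ₗ LinearMap.mul' ℂ A ∘ₗ
    TensorProduct.map
      (LinearMap.mulRight ℂ (Ring.inverse (P.sqrt P.g)) ∘ₗ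
        LinearMap.mulLeft ℂ (Ring.inverse (P.sqrt P.g)) ∘ₗ P.Jlin) LinearMap.id

section Contraction

set_option linter.unusedSectionVars false

@[simp] theorem lapp_tmul (φ : A →ₗ[ℂ] ℂ) (a b : A) : lapp φ (a ⊗ₜ[ℂ] b) = φ a • b := by
  simp [lapp]

@[simp] theorem rapp_tmul (φ : A →ₗ[ℂ] ℂ) (a b : A) : rapp φ (a ⊗ₜ[ℂ] b) = φ b • a := by
  simp [rapp]

@[simp] theorem papp_tmul (φ ψ : A →ₗ[ℂ] ℂ) (a b : A) :
    papp φ ψ (a ⊗ₜ[ℂ] b) = φ a * ψ b := by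
  simp [papp]

theorem lapp_one_tmul_mul (φ : A →ₗ[ℂ] ℂ) (b : A) (t : A ⊗[ℂ] A) :
    lapp φ ((1 ⊗ₜ[ℂ] b) * t) = b * lapp φ t := by
  induction t with
  | zero => simp
  | add x y hx hy => simp only [mul_add, map_add, hx, hy]
  | tmul c d => simp

theorem lapp_mul_one_tmul (φ : A →ₗ[ℂ] ℂ) (b : A) (t : A ⊗[ℂ] A) :
    lapp φ (t * (1 ⊗ₜ[ℂ] b)) = lapp φ t * b := by
  induction t with
  | zero => simp
  | add x y hx hy => simp only [add_mul, map_add, hx, hy]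
  | tmul c d => simp

theorem lapp_tmul_one_mul (φ : A →ₗ[ℂ] ℂ) (a : A) (t : A ⊗[ℂ] A) :
    lapp φ ((a ⊗ₜ[ℂ] 1) * t) = lapp (φ ∘ₗ LinearMap.mulLeft ℂ a) t := by
  induction t with
  | zero => simp
  | add x y hx hy => simp only [mul_add, map_add, hx, hy]
  | tmul c d => simp

theorem lapp_mul_tmul_one (φ : A →ₗ[ℂ] ℂ) (a : A) (t : A ⊗[ℂ] A) :
    lapp φ (t * (a ⊗ₜ[ℂ] 1)) = lapp (φ ∘ₗ LinearMap.mulRight ℂ a) t := by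
  induction t with
  | zero => simp
  | add x y hx hy => simp only [add_mul, map_add, hx, hy]
  | tmul c d => simp

theorem rapp_tmul_one_mul (φ : A →ₗ[ℂ] ℂ) (b : A) (t : A ⊗[ℂ] A) :
    rapp φ ((b ⊗ₜ[ℂ] 1) * t) = b * rapp φ t := by
  induction t with
  | zero => simp
  | add x y hx hy => simp only [mul_add, map_add, hx, hy]
  | tmul c d => simp

theorem rapp_mul_tmul_one (φ : A →ₗ[ℂ] ℂ) (b : A) (t : A ⊗[ℂ] A) :
    rapp φ (t * (b ⊗ₜ[ℂ] 1)) = rapp φ t * b := by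
  induction t with
  | zero => simp
  | add x y hx hy => simp only [add_mul, map_add, hx, hy]
  | tmul c d => simp

theorem rapp_one_tmul_mul (φ : A →ₗ[ℂ] ℂ) (a : A) (t : A ⊗[ℂ] A) :
    rapp φ ((1 ⊗ₜ[ℂ] a) * t) = rapp (φ ∘ₗ LinearMap.mulLeft ℂ a) t := by
  induction t with
  | zero => simp
  | add x y hx hy => simp only [mul_add, map_add, hx, hy]
  | tmul c d => simp

theorem rapp_comm (φ : A →ₗ[ℂ] ℂ) (t : A ⊗[ℂ] A) :
    rapp φ (TensorProduct.comm ℂ A A t) = lapp φ t := by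
  induction t with
  | zero => simp
  | add x y hx hy => simp only [map_add, hx, hy]
  | tmul c d => simp

theorem lapp_map (φ : A →ₗ[ℂ] ℂ) (f k : A →ₗ[ℂ] A) (t : A ⊗[ℂ] A) :
    lapp φ (TensorProduct.map f k t) = k (lapp (φ ∘ₗ f) t) := by
  induction t with
  | zero => simp
  | add x y hx hy => simp only [map_add, hx, hy]
  | tmul c d => simp

theorem rapp_map (φ : A →ₗ[ℂ] ℂ) (f k : A →ₗ[ℂ] A) (t : A ⊗[ℂ] A) :
    rapp φ (TensorProduct.map f k t) = f (rapp (φ ∘ₗ k) t) := by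
  induction t with
  | zero => simp
  | add x y hx hy => simp only [map_add, hx, hy]
  | tmul c d => simp

theorem apply_rapp (φ ψ : A →ₗ[ℂ] ℂ) (t : A ⊗[ℂ] A) :
    ψ (rapp φ t) = φ (lapp ψ t) := by
  induction t with
  | zero => simp
  | add x y hx hy => simp only [map_add, hx, hy]
  | tmul c d => simp [mul_comm]

theorem assoc_mul (x y : (A ⊗[ℂ] A) ⊗[ℂ] A) :
    TensorProduct.assoc ℂ A A A (x * y) =
      TensorProduct.assoc ℂ A A A x * TensorProduct.assoc ℂ A A A y :=
  map_mul (Algebra.TensorProduct.assoc ℂ ℂ ℂ A A A) x y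

end Contraction

/-- Two elements of a complex vector space agree if all functionals agree on them. -/
theorem eq_of_forall_functional_eq {V : Type*} [AddCommGroup V] [Module ℂ V] {x y : V}
    (hxy : ∀ φ : V →ₗ[ℂ] ℂ, φ x = φ y) : x = y := by
  rw [← sub_eq_zero, ← Module.forall_dual_apply_eq_zero_iff ℂ]
  intro φ
  rw [map_sub, hxy φ, sub_self]

namespace WeakHopfData

variable (W : WeakHopfData A)

theorem Δ_mul_Δ_one (x : A) : W.Δ x * W.Δ 1 = W.Δ x := by rw [← W.Δ_mul, mul_one]

theorem Δ_one_mul_Δ (x : A) : W.Δ 1 * W.Δ x = W.Δ x := by rw [← W.Δ_mul, one_mul]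

theorem rapp_counit (x : A) : rapp W.ε (W.Δ x) = x := LinearMap.congr_fun W.counit_right x

theorem lapp_counit (x : A) : lapp W.ε (W.Δ x) = x := LinearMap.congr_fun W.counit_left x

theorem coassoc_apply (x : A) :
    TensorProduct.assoc ℂ A A A (TensorProduct.map W.Δ LinearMap.id (W.Δ x)) =
      TensorProduct.map LinearMap.id W.Δ (W.Δ x) :=
  LinearMap.congr_fun W.coassoc x

theorem map_id_Δ_one :
    TensorProduct.map LinearMap.id W.Δ (W.Δ 1) =
      TensorProduct.assoc ℂ A A A (W.Δ 1 ⊗ₜ[ℂ] 1) * (1 ⊗ₜ[ℂ] W.Δ 1) := by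
  rw [← W.coassoc_apply, W.Δ_one_weak, assoc_mul, LinearEquiv.apply_symm_apply]

theorem map_id_Δ_one' :
    TensorProduct.map LinearMap.id W.Δ (W.Δ 1) =
      (1 ⊗ₜ[ℂ] W.Δ 1) * TensorProduct.assoc ℂ A A A (W.Δ 1 ⊗ₜ[ℂ] 1) := by
  rw [← W.coassoc_apply, W.Δ_one_weak', assoc_mul, LinearEquiv.apply_symm_apply]

theorem εL_eq (x : A) : W.εL x = lapp (W.ε ∘ₗ LinearMap.mulRight ℂ x) (W.Δ 1) :=
  W.antipode_left x

theorem εR_eq (x : A) : W.εR x = rapp (W.ε ∘ₗ LinearMap.mulLeft ℂ x) (W.Δ 1) :=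
  W.antipode_right x

theorem S_one : W.S 1 = 1 := by
  obtain ⟨y, hy⟩ := W.S.surjective 1
  have := W.S_antimul y 1
  rw [mul_one, hy, mul_one] at this
  exact this.symm

theorem εR_one : W.εR 1 = 1 := by
  rw [εR_eq, LinearMap.mulLeft_one, LinearMap.comp_id, rapp_counit]

/-- Membership in `A^L`, expressed through the comultiplication. -/
structure IsLeft (l : A) : Prop where
  left : W.Δ l = (l ⊗ₜ[ℂ] 1) * W.Δ 1
  right : W.Δ l = W.Δ 1 * (l ⊗ₜ[ℂ] 1)

/-- Membership in `A^R`, expressed through the comultiplication. -/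
structure IsRight (r : A) : Prop where
  left : W.Δ r = (1 ⊗ₜ[ℂ] r) * W.Δ 1
  right : W.Δ r = W.Δ 1 * (1 ⊗ₜ[ℂ] r)

variable {W}

theorem Δ_lapp (φ : A →ₗ[ℂ] ℂ) (t : A ⊗[ℂ] A) :
    W.Δ (lapp φ t) = TensorProduct.lid ℂ (A ⊗[ℂ] A)
      (TensorProduct.map φ LinearMap.id (TensorProduct.map LinearMap.id W.Δ t)) := by
  induction t with
  | zero => simp
  | add x y hx hy => simp only [map_add, hx, hy]
  | tmul c d => simp

theorem Δ_rapp (φ : A →ₗ[ℂ] ℂ) (t : A ⊗[ℂ] A) :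
    W.Δ (rapp φ t) = TensorProduct.rid ℂ (A ⊗[ℂ] A)
      (TensorProduct.map LinearMap.id φ (TensorProduct.map W.Δ LinearMap.id t)) := by
  induction t with
  | zero => simp
  | add x y hx hy => simp only [map_add, hx, hy]
  | tmul c d => simp

theorem IsLeft.lapp_Δ_one (φ : A →ₗ[ℂ] ℂ) : W.IsLeft (lapp φ (W.Δ 1)) := by
  constructor
  · rw [Δ_lapp, map_id_Δ_one]
    generalize W.Δ 1 = u
    generalize hv : u = v
    nth_rw 1 [← hv]
    nth_rw 2 [← hv]
    clear hv
    induction u with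
    | zero => simp
    | add x y hx hy => simp only [map_add, TensorProduct.add_tmul, add_mul, hx, hy]
    | tmul a b =>
      induction v with
      | zero => simp
      | add x y hx hy => simp only [map_add, TensorProduct.tmul_add, mul_add, hx, hy]
      | tmul c d => simp [TensorProduct.smul_tmul']
  · rw [Δ_lapp, map_id_Δ_one']
    generalize W.Δ 1 = u
    generalize hv : u = v
    nth_rw 2 [← hv]
    nth_rw 3 [← hv]
    clear hv
    induction u with
    | zero => simp
    | add x y hx hy => simp only [map_add, TensorProduct.add_tmul, mul_add, hx, hy]
    | tmul a b =>
      induction v with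
      | zero => simp
      | add x y hx hy => simp only [map_add, TensorProduct.tmul_add, add_mul, hx, hy]
      | tmul c d => simp [TensorProduct.smul_tmul']

theorem IsRight.rapp_Δ_one (φ : A →ₗ[ℂ] ℂ) : W.IsRight (rapp φ (W.Δ 1)) := by
  constructor
  · rw [Δ_rapp, W.Δ_one_weak']
    generalize W.Δ 1 = u
    generalize hv : u = v
    nth_rw 1 [← hv]
    nth_rw 2 [← hv]
    clear hv
    induction u with
    | zero => simp
    | add x y hx hy => simp only [map_add, TensorProduct.tmul_add, add_mul, hx, hy]
    | tmul a b =>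
      induction v with
      | zero => simp
      | add x y hx hy => simp only [map_add, TensorProduct.add_tmul, mul_add, hx, hy]
      | tmul c d => simp
  · rw [Δ_rapp, W.Δ_one_weak]
    generalize W.Δ 1 = u
    generalize hv : u = v
    nth_rw 2 [← hv]
    nth_rw 3 [← hv]
    clear hv
    induction u with
    | zero => simp
    | add x y hx hy => simp only [map_add, TensorProduct.tmul_add, mul_add, hx, hy]
    | tmul a b =>
      induction v with
      | zero => simp
      | add x y hx hy => simp only [map_add, TensorProduct.add_tmul, add_mul, hx, hy]
      | tmul c d => simp

end WeakHopfData

namespace WeakHopfData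

variable {W : WeakHopfData A}

theorem Δ_injective : Function.Injective W.Δ := by
  intro x y hxy
  rw [← W.lapp_counit x, hxy, W.lapp_counit]

theorem IsLeft.of_mem_range {l : A} (hl : l ∈ Set.range W.εL) : W.IsLeft l := by
  obtain ⟨x, rfl⟩ := hl
  rw [εL_eq]
  exact .lapp_Δ_one _

theorem IsRight.of_mem_range {r : A} (hr : r ∈ Set.range W.εR) : W.IsRight r := by
  obtain ⟨x, rfl⟩ := hr
  rw [εR_eq]
  exact .rapp_Δ_one _

theorem IsLeft.mul {l m : A} (hl : W.IsLeft l) (hm : W.IsLeft m) : W.IsLeft (l * m) := by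
  constructor
  · rw [W.Δ_mul, hl.left, hm.left, mul_assoc, ← mul_assoc (W.Δ 1), ← hm.right, Δ_mul_Δ_one,
      hm.left, ← mul_assoc, Algebra.TensorProduct.tmul_mul_tmul, one_mul]
  · rw [W.Δ_mul, hl.right, hm.right, mul_assoc, ← mul_assoc (l ⊗ₜ[ℂ] 1), ← hl.left, hl.right,
      mul_assoc, ← mul_assoc (W.Δ 1), Δ_one_mul_Δ, Algebra.TensorProduct.tmul_mul_tmul, one_mul]

theorem IsRight.mul {r s : A} (hr : W.IsRight r) (hs : W.IsRight s) : W.IsRight (r * s) := by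
  constructor
  · rw [W.Δ_mul, hr.left, hs.left, mul_assoc, ← mul_assoc (W.Δ 1), ← hs.right, Δ_mul_Δ_one,
      hs.left, ← mul_assoc, Algebra.TensorProduct.tmul_mul_tmul, one_mul]
  · rw [W.Δ_mul, hr.right, hs.right, mul_assoc, ← mul_assoc (1 ⊗ₜ[ℂ] r), ← hr.left, hr.right,
      mul_assoc, ← mul_assoc (W.Δ 1), Δ_one_mul_Δ, Algebra.TensorProduct.tmul_mul_tmul, one_mul]

theorem IsLeft.of_mul_eq_one {l m : A} (hl : W.IsLeft l) (hlm : l * m = 1) (hml : m * l = 1) :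
    W.IsLeft m := by
  constructor
  · calc W.Δ m = ((m * l) ⊗ₜ[ℂ] 1) * W.Δ 1 * W.Δ m := by
          rw [hml, ← Algebra.TensorProduct.one_def, one_mul, Δ_one_mul_Δ]
      _ = (m ⊗ₜ[ℂ] 1) * (W.Δ l * W.Δ m) := by
          rw [hl.left, ← mul_assoc, ← mul_assoc, Algebra.TensorProduct.tmul_mul_tmul, one_mul]
      _ = (m ⊗ₜ[ℂ] 1) * W.Δ 1 := by rw [← W.Δ_mul, hlm]
  · calc W.Δ m = W.Δ m * (W.Δ 1 * ((l * m) ⊗ₜ[ℂ] 1)) := by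
          rw [hlm, ← Algebra.TensorProduct.one_def, mul_one, Δ_mul_Δ_one]
      _ = (W.Δ m * W.Δ l) * (m ⊗ₜ[ℂ] 1) := by
          rw [hl.right, mul_assoc, mul_assoc, Algebra.TensorProduct.tmul_mul_tmul, one_mul]
      _ = W.Δ 1 * (m ⊗ₜ[ℂ] 1) := by rw [← W.Δ_mul, hml]

theorem IsRight.of_mul_eq_one {r s : A} (hr : W.IsRight r) (hrs : r * s = 1) (hsr : s * r = 1) :
    W.IsRight s := by
  constructor
  · calc W.Δ s = (1 ⊗ₜ[ℂ] (s * r)) * W.Δ 1 * W.Δ s := by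
          rw [hsr, ← Algebra.TensorProduct.one_def, one_mul, Δ_one_mul_Δ]
      _ = (1 ⊗ₜ[ℂ] s) * (W.Δ r * W.Δ s) := by
          rw [hr.left, ← mul_assoc, ← mul_assoc, Algebra.TensorProduct.tmul_mul_tmul, one_mul]
      _ = (1 ⊗ₜ[ℂ] s) * W.Δ 1 := by rw [← W.Δ_mul, hrs]
  · calc W.Δ s = W.Δ s * (W.Δ 1 * (1 ⊗ₜ[ℂ] (r * s))) := by
          rw [hrs, ← Algebra.TensorProduct.one_def, mul_one, Δ_mul_Δ_one]
      _ = (W.Δ s * W.Δ r) * (1 ⊗ₜ[ℂ] s) := by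
          rw [hr.right, mul_assoc, mul_assoc, Algebra.TensorProduct.tmul_mul_tmul, one_mul]
      _ = W.Δ 1 * (1 ⊗ₜ[ℂ] s) := by rw [← W.Δ_mul, hsr]

theorem IsLeft.commute {l r : A} (hl : W.IsLeft l) (hr : W.IsRight r) : l * r = r * l := by
  apply Δ_injective (W := W)
  rw [W.Δ_mul, W.Δ_mul, hl.left, hr.left, mul_assoc, mul_assoc, ← hl.left, ← hr.left,
    Δ_one_mul_Δ, Δ_one_mul_Δ, hl.left, hr.left, ← mul_assoc, ← mul_assoc,
    Algebra.TensorProduct.tmul_mul_tmul, Algebra.TensorProduct.tmul_mul_tmul]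
  simp

theorem IsLeft.Δ_mul_left {l : A} (hl : W.IsLeft l) (x : A) :
    W.Δ (l * x) = (l ⊗ₜ[ℂ] 1) * W.Δ x := by
  rw [W.Δ_mul, hl.left, mul_assoc, Δ_one_mul_Δ]

theorem IsRight.Δ_mul_left {r : A} (hr : W.IsRight r) (x : A) :
    W.Δ (r * x) = (1 ⊗ₜ[ℂ] r) * W.Δ x := by
  rw [W.Δ_mul, hr.left, mul_assoc, Δ_one_mul_Δ]

theorem IsLeft.εR_eq_S {l : A} (hl : W.IsLeft l) : W.εR l = W.S l := by
  have key : ∀ t : A ⊗[ℂ] A, LinearMap.mul' ℂ A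
      (TensorProduct.map W.S.toLinearMap LinearMap.id (t * (l ⊗ₜ[ℂ] 1))) =
      W.S l * LinearMap.mul' ℂ A (TensorProduct.map W.S.toLinearMap LinearMap.id t) := by
    intro t
    induction t with
    | zero => simp
    | add x y hx hy => simp only [map_add, add_mul, mul_add, hx, hy]
    | tmul c d => simp [W.S_antimul, mul_assoc]
  calc W.εR l = W.S l * W.εR 1 := by simp only [εR, LinearMap.comp_apply]; rw [hl.right, key]
    _ = W.S l := by rw [εR_one, mul_one]

theorem IsRight.εR_eq_self {r : A} (hr : W.IsRight r) : W.εR r = r := by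
  have key : ∀ t : A ⊗[ℂ] A, LinearMap.mul' ℂ A
      (TensorProduct.map W.S.toLinearMap LinearMap.id (t * (1 ⊗ₜ[ℂ] r))) =
      LinearMap.mul' ℂ A (TensorProduct.map W.S.toLinearMap LinearMap.id t) * r := by
    intro t
    induction t with
    | zero => simp
    | add x y hx hy => simp only [map_add, add_mul, hx, hy]
    | tmul c d => simp [mul_assoc]
  calc W.εR r = W.εR 1 * r := by simp only [εR, LinearMap.comp_apply]; rw [hr.right, key]
    _ = r := by rw [εR_one, one_mul]

/-- `x₍₁₎ ⊗ ε^L(x₍₂₎) = 1₍₁₎ x ⊗ 1₍₂₎`. -/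
theorem map_id_εL_Δ (x : A) :
    TensorProduct.map LinearMap.id W.εL (W.Δ x) = W.Δ 1 * (x ⊗ₜ[ℂ] 1) := by
  have key (a b : A) (u : A ⊗[ℂ] A) : TensorProduct.map (rapp W.ε) LinearMap.id
      ((TensorProduct.assoc ℂ A A A).symm (1 ⊗ₜ[ℂ] u) * ((a ⊗ₜ[ℂ] b) ⊗ₜ[ℂ] 1)) =
      a ⊗ₜ[ℂ] lapp (W.ε ∘ₗ LinearMap.mulRight ℂ b) u := by
    induction u with
    | zero => simp
    | add x y hx hy => simp only [map_add, TensorProduct.tmul_add, add_mul, hx, hy]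
    | tmul c d => simp [TensorProduct.smul_tmul]
  have key' (t : A ⊗[ℂ] A) : TensorProduct.map (rapp W.ε) LinearMap.id
      ((TensorProduct.assoc ℂ A A A).symm (1 ⊗ₜ[ℂ] W.Δ 1) * (t ⊗ₜ[ℂ] 1)) =
      TensorProduct.map LinearMap.id W.εL t := by
    induction t with
    | zero => simp
    | add x y hx hy => simp only [map_add, TensorProduct.add_tmul, mul_add, hx, hy]
    | tmul a b => rw [key, ← εL_eq, TensorProduct.map_tmul, LinearMap.id_apply]
  have hΔ (v : A ⊗[ℂ] A) : TensorProduct.map (rapp W.ε) LinearMap.id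
      (TensorProduct.map W.Δ LinearMap.id v) = v := by
    induction v with
    | zero => simp
    | add x y hx hy => simp only [map_add, hx, hy]
    | tmul c d => simp [rapp_counit]
  have hmul (v : A ⊗[ℂ] A) : TensorProduct.map W.Δ LinearMap.id (v * (x ⊗ₜ[ℂ] 1)) =
      TensorProduct.map W.Δ LinearMap.id v * (W.Δ x ⊗ₜ[ℂ] 1) := by
    induction v with
    | zero => simp
    | add x y hx hy => simp only [map_add, add_mul, hx, hy]
    | tmul c d => simp [W.Δ_mul]
  rw [← hΔ (W.Δ 1 * (x ⊗ₜ[ℂ] 1)), hmul, W.Δ_one_weak', mul_assoc,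
    Algebra.TensorProduct.tmul_mul_tmul, Δ_one_mul_Δ, mul_one, key']

theorem map_id_lapp_counit (v : A ⊗[ℂ] A) : TensorProduct.map LinearMap.id (lapp W.ε)
    (TensorProduct.map LinearMap.id W.Δ v) = v := by
  induction v with
  | zero => simp
  | add x y hx hy => simp only [map_add, hx, hy]
  | tmul c d => simp [lapp_counit]

/-- `ε^R(x₍₁₎) ⊗ x₍₂₎ = 1₍₁₎ ⊗ x 1₍₂₎`. -/
theorem map_εR_id_Δ (x : A) :
    TensorProduct.map W.εR LinearMap.id (W.Δ x) = (1 ⊗ₜ[ℂ] x) * W.Δ 1 := by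
  have key (a b : A) (u : A ⊗[ℂ] A) : TensorProduct.map LinearMap.id (lapp W.ε)
      ((1 ⊗ₜ[ℂ] (a ⊗ₜ[ℂ] b)) * TensorProduct.assoc ℂ A A A (u ⊗ₜ[ℂ] 1)) =
      rapp (W.ε ∘ₗ LinearMap.mulLeft ℂ a) u ⊗ₜ[ℂ] b := by
    induction u with
    | zero => simp
    | add x y hx hy => simp only [map_add, TensorProduct.add_tmul, mul_add, hx, hy]
    | tmul c d => simp [TensorProduct.smul_tmul]
  have key' (t : A ⊗[ℂ] A) : TensorProduct.map LinearMap.id (lapp W.ε)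
      ((1 ⊗ₜ[ℂ] t) * TensorProduct.assoc ℂ A A A (W.Δ 1 ⊗ₜ[ℂ] 1)) =
      TensorProduct.map W.εR LinearMap.id t := by
    induction t with
    | zero => simp
    | add x y hx hy => simp only [map_add, TensorProduct.tmul_add, add_mul, hx, hy]
    | tmul a b => rw [key, ← εR_eq, TensorProduct.map_tmul, LinearMap.id_apply]
  have hmul (v : A ⊗[ℂ] A) : TensorProduct.map LinearMap.id W.Δ ((1 ⊗ₜ[ℂ] x) * v) =
      (1 ⊗ₜ[ℂ] W.Δ x) * TensorProduct.map LinearMap.id W.Δ v := by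
    induction v with
    | zero => simp
    | add x y hx hy => simp only [map_add, mul_add, hx, hy]
    | tmul c d => simp [W.Δ_mul]
  rw [← map_id_lapp_counit (W := W) ((1 ⊗ₜ[ℂ] x) * W.Δ 1), hmul, W.map_id_Δ_one', ← mul_assoc,
    Algebra.TensorProduct.tmul_mul_tmul, Δ_mul_Δ_one, mul_one, key']

theorem ε_εR_mul (x y : A) : W.ε (W.εR x * y) = W.ε (x * y) := by
  have key (t : A ⊗[ℂ] A) : papp (W.ε ∘ₗ LinearMap.mulRight ℂ y) (W.ε ∘ₗ LinearMap.mulLeft ℂ x) t =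
      W.ε (rapp (W.ε ∘ₗ LinearMap.mulLeft ℂ x) t * y) := by
    induction t with
    | zero => simp
    | add x y hx hy => simp only [map_add, add_mul, hx, hy]
    | tmul c d => simp [mul_comm]
  have h := W.ε_weak' x 1 y
  rw [mul_one] at h
  rw [h, key, εR_eq]

/-- `S⁻¹(ε^L(x)) = 1₍₁₎ ε(1₍₂₎ x)`. -/
theorem S_symm_εL (x : A) :
    W.S.symm (W.εL x) = rapp (W.ε ∘ₗ LinearMap.mulRight ℂ x) (W.Δ 1) := by
  rw [LinearEquiv.symm_apply_eq]
  apply eq_of_forall_functional_eq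
  intro φ
  have key (t : A ⊗[ℂ] A) : φ (lapp (W.ε ∘ₗ LinearMap.mulRight ℂ x) (TensorProduct.comm ℂ A A
      (TensorProduct.map W.S.toLinearMap W.S.toLinearMap t))) =
      W.ε (W.S (lapp (φ ∘ₗ W.S.toLinearMap) t) * x) := by
    induction t with
    | zero => simp
    | add x y hx hy => simp only [map_add, add_mul, hx, hy]
    | tmul c d => simp [mul_comm]
  calc φ (W.εL x) = φ (lapp (W.ε ∘ₗ LinearMap.mulRight ℂ x) (W.Δ (W.S 1))) := by
        rw [S_one, εL_eq]
    _ = W.ε (lapp (φ ∘ₗ W.S.toLinearMap) (W.Δ 1) * x) := by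
        rw [W.S_anticomul, key, ← (IsLeft.lapp_Δ_one _).εR_eq_S, ε_εR_mul]
    _ = φ (W.S (rapp (W.ε ∘ₗ LinearMap.mulRight ℂ x) (W.Δ 1))) :=
        (apply_rapp (W.ε ∘ₗ LinearMap.mulRight ℂ x) (φ ∘ₗ W.S.toLinearMap) (W.Δ 1)).symm

/-- `S⁻¹(ε^L(x₍₁₎)) ⊗ x₍₂₎ = 1₍₁₎ ⊗ 1₍₂₎ x`. -/
theorem map_S_symm_εL_id_Δ (x : A) :
    TensorProduct.map (W.S.symm.toLinearMap ∘ₗ W.εL) LinearMap.id (W.Δ x) =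
      W.Δ 1 * (1 ⊗ₜ[ℂ] x) := by
  have key (a b : A) (u : A ⊗[ℂ] A) : TensorProduct.map LinearMap.id (lapp W.ε)
      (TensorProduct.assoc ℂ A A A (u ⊗ₜ[ℂ] 1) * (1 ⊗ₜ[ℂ] (a ⊗ₜ[ℂ] b))) =
      rapp (W.ε ∘ₗ LinearMap.mulRight ℂ a) u ⊗ₜ[ℂ] b := by
    induction u with
    | zero => simp
    | add x y hx hy => simp only [map_add, TensorProduct.add_tmul, add_mul, hx, hy]
    | tmul c d => simp [TensorProduct.smul_tmul]
  have key' (t : A ⊗[ℂ] A) : TensorProduct.map LinearMap.id (lapp W.ε)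
      (TensorProduct.assoc ℂ A A A (W.Δ 1 ⊗ₜ[ℂ] 1) * (1 ⊗ₜ[ℂ] t)) =
      TensorProduct.map (W.S.symm.toLinearMap ∘ₗ W.εL) LinearMap.id t := by
    induction t with
    | zero => simp
    | add x y hx hy => simp only [map_add, TensorProduct.tmul_add, mul_add, hx, hy]
    | tmul a b =>
      rw [key, ← S_symm_εL, TensorProduct.map_tmul, LinearMap.id_apply]
      rfl
  have hmul (v : A ⊗[ℂ] A) : TensorProduct.map LinearMap.id W.Δ (v * (1 ⊗ₜ[ℂ] x)) =
      TensorProduct.map LinearMap.id W.Δ v * (1 ⊗ₜ[ℂ] W.Δ x) := by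
    induction v with
    | zero => simp
    | add x y hx hy => simp only [map_add, add_mul, hx, hy]
    | tmul c d => simp [W.Δ_mul]
  rw [← map_id_lapp_counit (W := W) (W.Δ 1 * (1 ⊗ₜ[ℂ] x)), hmul, W.map_id_Δ_one, mul_assoc,
    Algebra.TensorProduct.tmul_mul_tmul, Δ_one_mul_Δ, mul_one, key']

theorem mul'_map_S_εL_Δ (x : A) :
    LinearMap.mul' ℂ A (TensorProduct.map W.S.toLinearMap W.εL (W.Δ x)) = W.S x := by
  have key (t : A ⊗[ℂ] A) : LinearMap.mul' ℂ A
      (TensorProduct.map W.S.toLinearMap LinearMap.id (t * (x ⊗ₜ[ℂ] 1))) =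
      W.S x * LinearMap.mul' ℂ A (TensorProduct.map W.S.toLinearMap LinearMap.id t) := by
    induction t with
    | zero => simp
    | add x y hx hy => simp only [map_add, add_mul, mul_add, hx, hy]
    | tmul c d => simp [W.S_antimul, mul_assoc]
  have h₁ : TensorProduct.map W.S.toLinearMap W.εL (W.Δ x) =
      TensorProduct.map W.S.toLinearMap LinearMap.id
        (TensorProduct.map LinearMap.id W.εL (W.Δ x)) := by
    rw [TensorProduct.map_map, LinearMap.comp_id, LinearMap.id_comp]
  have h₂ : LinearMap.mul' ℂ A (TensorProduct.map W.S.toLinearMap LinearMap.id (W.Δ 1)) = W.εR 1 :=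
    rfl
  rw [h₁, map_id_εL_Δ, key, h₂, εR_one, mul_one]

theorem IsRight.star_right {r : A} (hr : W.IsRight r) : W.IsRight (star r) := by
  have hmulr (t : A ⊗[ℂ] A) : W.starT (t * (1 ⊗ₜ[ℂ] r)) = (1 ⊗ₜ[ℂ] star r) * W.starT t := by
    induction t with
    | zero =>
      have h0 : W.starT 0 = 0 := by simpa using W.starT_tmul 0 0
      simp [h0]
    | add x y hx hy => simp only [W.starT_add, add_mul, mul_add, hx, hy]
    | tmul c d => simp [W.starT_tmul]
  have hmull (t : A ⊗[ℂ] A) : W.starT ((1 ⊗ₜ[ℂ] r) * t) = W.starT t * (1 ⊗ₜ[ℂ] star r) := by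
    induction t with
    | zero =>
      have h0 : W.starT 0 = 0 := by simpa using W.starT_tmul 0 0
      simp [h0]
    | add x y hx hy => simp only [W.starT_add, add_mul, mul_add, hx, hy]
    | tmul c d => simp [W.starT_tmul]
  constructor
  · rw [W.Δ_star, hr.right, hmulr, ← W.Δ_star, star_one]
  · rw [W.Δ_star, hr.left, hmull, ← W.Δ_star, star_one]

end WeakHopfData

section SquareRoot

open Polynomial in
/-- A square root of `g` of the form `star y * y` is a real polynomial in `g`. -/
theorem IsPosElem.exists_aeval_mul_self_eq {s : A} (hs : IsPosElem s) :
    ∃ p : ℝ[X], aeval (s * s) p = s := by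
  let _ : CompleteSpace A := FiniteDimensional.complete ℂ A
  let _ : CStarAlgebra A := { }
  have : FiniteDimensional ℝ A := FiniteDimensional.complexToReal A
  obtain ⟨y, rfl⟩ := hs
  have hsa : IsSelfAdjoint (star y * y) := .star_mul_self y
  have hnn : ∀ x ∈ spectrum ℝ (star y * y), 0 ≤ x := spectrum_star_mul_self_nonneg
  generalize star y * y = s at hsa hnn
  have hfin : (spectrum ℝ s).Finite := by
    refine ((minpoly ℝ s).rootSet_finite ℝ).subset fun x hx => ?_
    have hne : minpoly ℝ s ≠ 0 := minpoly.ne_zero (Algebra.IsIntegral.isIntegral s)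
    rw [mem_rootSet]
    refine ⟨hne, ?_⟩
    have h := spectrum.subset_polynomial_aeval s (minpoly ℝ s) ⟨x, hx, rfl⟩
    rw [minpoly.aeval] at h
    by_contra hx0
    rw [spectrum.mem_iff, sub_zero] at h
    exact h ((isUnit_iff_ne_zero.mpr (by simpa using hx0)).map (algebraMap ℝ A))
  let p : ℝ[X] := Lagrange.interpolate hfin.toFinset (fun x => x ^ 2) id
  refine ⟨p, ?_⟩
  calc aeval (s * s) p = aeval s (p.comp (X ^ 2)) := by simp [aeval_comp, pow_two]
    _ = cfc (p.comp (X ^ 2)).eval s := (cfc_polynomial _ s hsa).symm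
    _ = cfc id s := by
      refine cfc_congr fun x hx => ?_
      have hinj : Set.InjOn (fun x : ℝ => x ^ 2) hfin.toFinset := by
        intro a ha b hb hab
        simp only [Set.Finite.coe_toFinset] at ha hb
        exact (pow_left_inj₀ (hnn a ha) (hnn b hb) two_ne_zero).mp hab
      simpa only [eval_comp, eval_pow, eval_X] using
        Lagrange.eval_interpolate_at_node id hinj (hfin.mem_toFinset.mpr hx)
    _ = s := cfc_id ℝ s

/-- A positive square root of `g` lies in the algebra generated by `g`. -/
theorem IsPosElem.mem_adjoin_mul_self {s : A} (hs : IsPosElem s) :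
    s ∈ Algebra.adjoin ℂ {s * s} := by
  obtain ⟨p, hp⟩ := hs.exists_aeval_mul_self_eq
  have h := Polynomial.aeval_mem_adjoin_singleton ℂ (s * s) (p := p.map (algebraMap ℝ ℂ))
  rwa [Polynomial.aeval_map_algebraMap, hp] at h

end SquareRoot

theorem IsPosElem.star_eq {B : Type*} [Semigroup B] [StarMul B] {x : B} (hx : IsPosElem x) : star x = x := by
  obtain ⟨y, rfl⟩ := hx
  simp

namespace WeakHopfData

variable {W : WeakHopfData A}

theorem lapp_Δ_rapp_Δ (φ ψ : A →ₗ[ℂ] ℂ) (x : A) :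
    lapp φ (W.Δ (rapp ψ (W.Δ x))) = rapp ψ (W.Δ (lapp φ (W.Δ x))) := by
  have h₁ (t : A ⊗[ℂ] A) : lapp φ (W.Δ (rapp ψ t)) =
      TensorProduct.lid ℂ A (TensorProduct.map φ (rapp ψ)
        (TensorProduct.assoc ℂ A A A (TensorProduct.map W.Δ LinearMap.id t))) := by
    induction t with
    | zero => simp
    | add x y hx hy => simp only [map_add, hx, hy]
    | tmul a b =>
      simp only [rapp_tmul, map_smul, TensorProduct.map_tmul, LinearMap.id_apply]
      generalize W.Δ a = u
      induction u with
      | zero => simp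
      | add x y hx hy => simp only [map_add, smul_add, TensorProduct.add_tmul, hx, hy]
      | tmul c d => simp [smul_smul, mul_comm]
  have h₂ (t : A ⊗[ℂ] A) : rapp ψ (W.Δ (lapp φ t)) =
      TensorProduct.lid ℂ A (TensorProduct.map φ (rapp ψ)
        (TensorProduct.map LinearMap.id W.Δ t)) := by
    induction t with
    | zero => simp
    | add x y hx hy => simp only [map_add, hx, hy]
    | tmul a b => simp
  rw [h₁, h₂, coassoc_apply]

theorem ε_lapp_Δ (φ : A →ₗ[ℂ] ℂ) (x : A) : W.ε (lapp φ (W.Δ x)) = φ x := by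
  rw [← apply_rapp, rapp_counit]

variable (W) in
/-- The subspace `A^R`. -/
def rightSubspace : Submodule ℂ A where
  carrier := {r | W.IsRight r}
  zero_mem' := by constructor <;> simp
  add_mem' hr hs := by
    constructor
    · rw [map_add, hr.left, hs.left, TensorProduct.tmul_add, add_mul]
    · rw [map_add, hr.right, hs.right, TensorProduct.tmul_add, mul_add]
  smul_mem' c r hr := by
    constructor
    · rw [map_smul, hr.left, TensorProduct.tmul_smul, smul_mul_assoc]
    · rw [map_smul, hr.right, TensorProduct.tmul_smul, mul_smul_comm]

end WeakHopfData

namespace HaarPkg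

open WeakHopfData

variable (P : HaarPkg A)

/-- `S(x) h₍₁₎ ⊗ h₍₂₎ = h₍₁₎ ⊗ x h₍₂₎`. -/
theorem S_tmul_one_mul_Δ_h (x : A) :
    (P.W.S x ⊗ₜ[ℂ] 1) * P.W.Δ P.h = (1 ⊗ₜ[ℂ] x) * P.W.Δ P.h := by
  let F : A ⊗[ℂ] A →ₗ[ℂ] A ⊗[ℂ] A := TensorProduct.map (LinearMap.mul' ℂ A) LinearMap.id ∘ₗ
    (TensorProduct.assoc ℂ A A A).symm.toLinearMap ∘ₗ TensorProduct.map P.W.S.toLinearMap P.W.Δ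
  have hF₁ (t : A ⊗[ℂ] A) : F t * P.W.Δ P.h =
      (LinearMap.mul' ℂ A (TensorProduct.map P.W.S.toLinearMap P.W.εL t) ⊗ₜ[ℂ] 1) *
        P.W.Δ P.h := by
    induction t with
    | zero => simp
    | add x y hx hy => simp only [map_add, TensorProduct.add_tmul, add_mul, hx, hy]
    | tmul a b =>
      have h₁ (u : A ⊗[ℂ] A) : TensorProduct.map (LinearMap.mul' ℂ A) LinearMap.id
          ((TensorProduct.assoc ℂ A A A).symm (P.W.S a ⊗ₜ[ℂ] u)) = (P.W.S a ⊗ₜ[ℂ] 1) * u := by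
        induction u with
        | zero => simp
        | add x y hx hy => simp only [map_add, TensorProduct.tmul_add, mul_add, hx, hy]
        | tmul c d => simp
      have h₂ : F (a ⊗ₜ[ℂ] b) = (P.W.S a ⊗ₜ[ℂ] 1) * P.W.Δ b := by
        rw [← h₁]; simp [F]
      have hl : P.W.IsLeft (P.W.εL b) := .of_mem_range ⟨b, rfl⟩
      rw [h₂, mul_assoc, ← P.W.Δ_mul, P.haar_left, hl.Δ_mul_left, ← mul_assoc]
      simp
  have hF₂ (t : A ⊗[ℂ] A) : TensorProduct.map (LinearMap.mul' ℂ A) LinearMap.id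
      ((TensorProduct.assoc ℂ A A A).symm (TensorProduct.map P.W.S.toLinearMap LinearMap.id
        (TensorProduct.assoc ℂ A A A (TensorProduct.map P.W.Δ LinearMap.id t)))) =
      TensorProduct.map P.W.εR LinearMap.id t := by
    induction t with
    | zero => simp
    | add x y hx hy => simp only [map_add, hx, hy]
    | tmul a b =>
      simp only [TensorProduct.map_tmul, LinearMap.id_apply, εR, LinearMap.comp_apply]
      generalize P.W.Δ a = u
      induction u with
      | zero => simp
      | add x y hx hy => simp only [map_add, TensorProduct.add_tmul, hx, hy]
      | tmul c d => simp
  have hF₃ : F (P.W.Δ x) = TensorProduct.map P.W.εR LinearMap.id (P.W.Δ x) := by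
    rw [← hF₂, coassoc_apply, TensorProduct.map_map, LinearMap.comp_id, LinearMap.id_comp]
    rfl
  rw [← mul'_map_S_εL_Δ, ← hF₁, hF₃, map_εR_id_Δ, mul_assoc, Δ_one_mul_Δ]

/-- `h₍₁₎ ⊗ h₍₂₎ S(x) = h₍₁₎ x ⊗ h₍₂₎`. -/
theorem Δ_h_mul_one_tmul_S (x : A) :
    P.W.Δ P.h * (1 ⊗ₜ[ℂ] P.W.S x) = P.W.Δ P.h * (x ⊗ₜ[ℂ] 1) := by
  have key (a b : A) (t : A ⊗[ℂ] A) : TensorProduct.comm ℂ A A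
      (TensorProduct.map P.W.S.toLinearMap P.W.S.toLinearMap ((a ⊗ₜ[ℂ] b) * t)) =
      TensorProduct.comm ℂ A A
      (TensorProduct.map P.W.S.toLinearMap P.W.S.toLinearMap t) *
        (P.W.S b ⊗ₜ[ℂ] P.W.S a) := by
    induction t with
    | zero => simp
    | add x y hx hy => simp only [map_add, add_mul, mul_add, hx, hy]
    | tmul c d => simp [P.W.S_antimul]
  obtain ⟨y, rfl⟩ := P.W.S.surjective x
  have h := congrArg (fun t => TensorProduct.comm ℂ A A
    (TensorProduct.map P.W.S.toLinearMap P.W.S.toLinearMap t)) (P.S_tmul_one_mul_Δ_h y)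
  simpa only [key, ← P.W.S_anticomul, P.haar_S, S_one] using h

theorem rapp_hHat_mulLeft (x : A) :
    rapp (P.hHat ∘ₗ LinearMap.mulLeft ℂ x) (P.W.Δ P.h) = P.W.S x * (P.gL * P.gL) := by
  rw [← rapp_one_tmul_mul, ← S_tmul_one_mul_Δ_h, rapp_tmul_one_mul, P.gL_sq]

theorem lapp_hHat_mulRight (x : A) :
    lapp (P.hHat ∘ₗ LinearMap.mulRight ℂ x) (P.W.Δ P.h) = P.gR * P.gR * P.W.S x := by
  rw [← lapp_mul_tmul_one, ← Δ_h_mul_one_tmul_S, lapp_mul_one_tmul, P.gR_sq]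

theorem g_mul_lapp_mul_g (φ : A →ₗ[ℂ] ℂ) :
    P.g * (lapp φ (P.W.Δ P.h) * P.g) = rapp φ (P.W.Δ P.h) := by
  have h := congrArg (lapp φ) P.haar_flip
  have hc : lapp φ (TensorProduct.comm ℂ A A (P.W.Δ P.h)) = rapp φ (P.W.Δ P.h) := by
    rw [← rapp_comm, ← LinearEquiv.trans_apply, TensorProduct.comm_trans_comm,
      LinearEquiv.refl_apply]
  rw [lapp_map, hc, LinearMap.comp_id] at h
  exact h

end HaarPkg

theorem commute_ringInverse {R : Type*} [Ring R] {a b : R} (h : Commute a b) (hb : IsUnit b) :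
    Commute a (Ring.inverse b) := by
  obtain ⟨b, rfl⟩ := hb
  rw [Ring.inverse_unit]
  exact h.units_inv_right

namespace HaarPkg

open WeakHopfData

variable (P : HaarPkg A)

theorem gL_isLeft : P.W.IsLeft P.gL := .of_mem_range P.gL_mem

theorem gR_isRight : P.W.IsRight P.gR := .of_mem_range P.gR_mem

theorem inverse_gL_isLeft : P.W.IsLeft (Ring.inverse P.gL) :=
  P.gL_isLeft.of_mul_eq_one (Ring.mul_inverse_cancel _ P.gL_unit)
    (Ring.inverse_mul_cancel _ P.gL_unit)

theorem inverse_gR_isRight : P.W.IsRight (Ring.inverse P.gR) :=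
  P.gR_isRight.of_mul_eq_one (Ring.mul_inverse_cancel _ P.gR_unit)
    (Ring.inverse_mul_cancel _ P.gR_unit)

theorem g_isUnit : IsUnit P.g := P.g_unit

theorem g_mul_gR : P.g * P.gR = P.gL := Ring.inverse_mul_cancel_right _ _ P.gR_unit

theorem commute_gL_g : Commute P.gL P.g :=
  (Commute.refl _).mul_right (P.gL_isLeft.commute P.inverse_gR_isRight)

theorem commute_gR_g : Commute P.gR P.g := by
  refine Commute.mul_right P.gLR_comm.symm ?_
  rw [Commute, SemiconjBy, Ring.mul_inverse_cancel _ P.gR_unit,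
    Ring.inverse_mul_cancel _ P.gR_unit]

theorem gR_mul_g : P.gR * P.g = P.gL := by rw [P.commute_gR_g.eq, g_mul_gR]

theorem S_gR : P.W.S P.gR = P.gL := by
  rw [P.gR_S, P.S_sq]
  change P.g * P.gL * Ring.inverse P.g = P.gL
  rw [← P.commute_gL_g.eq, Ring.mul_inverse_cancel_right _ _ P.g_isUnit]

theorem S_gL_mul_gR : P.W.S (P.gL * P.gR) = P.gL * P.gR := by
  rw [P.W.S_antimul, S_gR, ← P.gR_S]

/-- The modular property of the dual Haar integral. -/
theorem hHat_modular (x w : A) :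
    P.hHat (x * (P.gL * P.gR) * w) = P.hHat (w * (P.gL * P.gR * x)) := by
  have h : lapp (P.hHat ∘ₗ LinearMap.mulLeft ℂ (x * (P.gL * P.gR))) (P.W.Δ P.h) =
      lapp (P.hHat ∘ₗ LinearMap.mulRight ℂ (P.gL * P.gR * x)) (P.W.Δ P.h) := by
    apply P.g_isUnit.mul_right_cancel
    apply P.g_isUnit.mul_left_cancel
    rw [g_mul_lapp_mul_g, rapp_hHat_mulLeft, lapp_hHat_mulRight, P.W.S_antimul x,
      P.W.S_antimul _ x, S_gL_mul_gR]
    calc P.gL * P.gR * P.W.S x * (P.gL * P.gL)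
        = P.gL * P.gR * P.W.S x * (P.gL * (P.gR * P.g)) := by rw [gR_mul_g]
      _ = (P.g * P.gR) * P.gR * P.W.S x * (P.gL * (P.gR * P.g)) := by rw [g_mul_gR]
      _ = P.g * (P.gR * P.gR * (P.W.S x * (P.gL * P.gR)) * P.g) := by simp only [mul_assoc]
  obtain ⟨-, ψ, -, rfl⟩ := P.haar_nondeg w
  have hl := apply_rapp ψ (P.hHat ∘ₗ LinearMap.mulLeft ℂ (x * (P.gL * P.gR))) (P.W.Δ P.h)
  rw [h, ← apply_rapp] at hl
  exact hl

theorem isUnit_gL_mul_gR : IsUnit (P.gL * P.gR) := P.gL_unit.mul P.gR_unit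

theorem hHat_mul_comm_of_commute {c : A} (hc : Commute c (P.gL * P.gR)) (w : A) :
    P.hHat (c * w) = P.hHat (w * c) := by
  have h := P.hHat_modular (Ring.inverse (P.gL * P.gR) * c) w
  rwa [mul_assoc _ c, hc.eq, Ring.inverse_mul_cancel_left _ _ P.isUnit_gL_mul_gR,
    Ring.mul_inverse_cancel_left _ _ P.isUnit_gL_mul_gR] at h

theorem eq_zero_of_hHat_mul {z : A} (hz : ∀ y, P.hHat (y * z) = 0) : z = 0 := by
  have h := P.lapp_hHat_mulRight z
  have h0 : P.hHat ∘ₗ LinearMap.mulRight ℂ z = 0 := LinearMap.ext hz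
  have h1 (t : A ⊗[ℂ] A) : lapp (0 : A →ₗ[ℂ] ℂ) t = 0 := by simp [lapp]
  rw [h0, h1] at h
  exact P.W.S.map_eq_zero_iff.mp
    (((P.gR_unit.mul P.gR_unit).mul_right_eq_zero).mp h.symm)

theorem hHat_mul_eq_zero {z : A} (hz : P.hHat (star z * z) = 0) (y : A) :
    P.hHat (star y * z) = 0 := by
  obtain ⟨b, hb0, hb⟩ := P.hHat_pos y
  have expand (t : ℂ) : P.hHat (star (z + t • y) * (z + t • y)) =
      t * P.hHat (star z * y) + star t * P.hHat (star y * z) + star t * t * b := by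
    simp only [star_add, star_smul, add_mul, mul_add, map_add, smul_mul_assoc, mul_smul_comm,
      map_smul, smul_eq_mul, hz, hb]
    ring
  set a := P.hHat (star y * z) with ha
  set c := P.hHat (star z * y) with hcdef
  have hre (t : ℂ) : 0 ≤ (t * c + star t * a + star t * t * b).re ∧
      (t * c + star t * a + star t * t * b).im = 0 := by
    obtain ⟨r, hr0, hr⟩ := P.hHat_pos (z + t • y)
    rw [expand] at hr
    rw [hr]
    simpa using hr0
  have h1 := (hre 1).2
  have hI := (hre Complex.I).2
  simp at h1 hI
  have hs (s : ℝ) : 0 ≤ -(2 * s * (a.re ^ 2 + a.im ^ 2)) + s ^ 2 * (a.re ^ 2 + a.im ^ 2) * b := by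
    have h := (hre (-s * a)).1
    simp at h
    have e1 : c.im = -a.im := by linarith
    have e2 : c.re = a.re := by linarith
    rw [e1, e2] at h
    nlinarith
  have hn : a.re ^ 2 + a.im ^ 2 ≤ 0 := by
    have h := hs (1 / (b + 1))
    have hb1 : 0 < b + 1 := by linarith
    field_simp at h
    nlinarith [sq_nonneg a.re, sq_nonneg a.im]
  have h2 : a.re = 0 := by nlinarith [sq_nonneg a.re, sq_nonneg a.im]
  have h3 : a.im = 0 := by nlinarith [sq_nonneg a.re, sq_nonneg a.im]
  exact Complex.ext h2 h3

theorem eq_zero_of_hHat_star_mul_self {z : A} (hz : P.hHat (star z * z) = 0) : z = 0 :=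
  P.eq_zero_of_hHat_mul fun y => by simpa using P.hHat_mul_eq_zero hz (star y)

theorem lapp_hHat_Δ_isRight (y : A) : P.W.IsRight (lapp P.hHat (P.W.Δ y)) := by
  obtain ⟨-, ψ, -, rfl⟩ := P.haar_nondeg y
  have hr : P.W.IsRight (Ring.inverse P.gR * Ring.inverse P.gR) :=
    P.inverse_gR_isRight.mul P.inverse_gR_isRight
  have h : rapp ψ (P.W.Δ P.h) = rapp (ψ ∘ₗ LinearMap.mulLeft ℂ (P.gR * P.gR))
      (P.W.Δ (Ring.inverse P.gR * Ring.inverse P.gR * P.h)) := by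
    rw [← rapp_one_tmul_mul, hr.Δ_mul_left, ← mul_assoc, Algebra.TensorProduct.tmul_mul_tmul,
      one_mul, mul_assoc P.gR, Ring.mul_inverse_cancel_left _ _ P.gR_unit,
      Ring.mul_inverse_cancel _ P.gR_unit, ← Algebra.TensorProduct.one_def, one_mul]
  rw [h, lapp_Δ_rapp_Δ, P.hHat_dual₄]
  exact .rapp_Δ_one _

theorem inverse_gL_sq_isLeft : P.W.IsLeft (Ring.inverse P.gL * Ring.inverse P.gL) :=
  P.inverse_gL_isLeft.mul P.inverse_gL_isLeft

theorem jayEl_eq : P.jayEl = lapp (P.hHat ∘ₗ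
    LinearMap.mulLeft ℂ (Ring.inverse P.gL * Ring.inverse P.gL)) (P.W.Δ 1) := by
  rw [jayEl, P.inverse_gL_sq_isLeft.left, lapp_tmul_one_mul]

theorem jayEl_isRight : P.W.IsRight P.jayEl := P.lapp_hHat_Δ_isRight _

theorem jayEl_isLeft : P.W.IsLeft P.jayEl := by
  rw [jayEl_eq]
  exact .lapp_Δ_one _

theorem S_jayEl : P.W.S P.jayEl = P.jayEl := by
  rw [← P.jayEl_isLeft.εR_eq_S, P.jayEl_isRight.εR_eq_self]

theorem S_symm_apply (a : A) : P.W.S.symm a = Ring.inverse P.g * P.W.S a * P.g := by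
  have h := P.S_sq (P.W.S.symm a)
  change _ = P.g * P.W.S.symm a * Ring.inverse P.g at h
  rw [LinearEquiv.apply_symm_apply] at h
  rw [h, mul_assoc P.g, Ring.inverse_mul_cancel_left _ _ P.g_isUnit,
    Ring.inverse_mul_cancel_right _ _ P.g_isUnit]

theorem hHat_S_symm_swap (a b : A) :
    P.hHat (Ring.inverse P.gL * Ring.inverse P.gL * P.W.S.symm (a * P.W.S b)) =
      P.hHat (Ring.inverse P.gL * Ring.inverse P.gL * (P.W.S a * b)) := by
  have hS : P.W.S.symm (a * P.W.S b) = b * P.W.S.symm a := by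
    rw [LinearEquiv.symm_apply_eq, P.W.S_antimul, LinearEquiv.apply_symm_apply]
  have hgk : Commute P.g (P.gL * P.gR) :=
    P.commute_gL_g.symm.mul_right P.commute_gR_g.symm
  set k := P.gL * P.gR with hk
  have hki : IsUnit k := P.isUnit_gL_mul_gR
  have hkk : Commute (Ring.inverse k) k := by
    rw [Commute, SemiconjBy, Ring.mul_inverse_cancel _ hki, Ring.inverse_mul_cancel _ hki]
  have hli : k * (Ring.inverse P.gL * Ring.inverse P.gL) = Ring.inverse P.g := by
    apply P.g_isUnit.mul_left_cancel
    rw [Ring.mul_inverse_cancel _ P.g_isUnit, hk, P.gLR_comm, mul_assoc,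
      Ring.mul_inverse_cancel_left _ _ P.gL_unit, ← mul_assoc, g_mul_gR,
      Ring.mul_inverse_cancel _ P.gL_unit]
  have hli' : Ring.inverse P.gL * Ring.inverse P.gL = Ring.inverse k * Ring.inverse P.g := by
    rw [← hli, Ring.inverse_mul_cancel_left _ _ hki]
  have hgki : Commute P.g (Ring.inverse k) := commute_ringInverse hgk hki
  rw [hS, S_symm_apply]
  calc P.hHat (Ring.inverse P.gL * Ring.inverse P.gL * (b * (Ring.inverse P.g * P.W.S a * P.g)))
      = P.hHat ((Ring.inverse P.gL * Ring.inverse P.gL * b * Ring.inverse P.g * P.W.S a) * P.g) := by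
        simp only [mul_assoc]
    _ = P.hHat (Ring.inverse k * (b * (Ring.inverse P.g * P.W.S a))) := by
        rw [← P.hHat_mul_comm_of_commute hgk, hli']
        simp only [← mul_assoc]
        rw [hgki.eq, Ring.mul_inverse_cancel_right _ _ P.g_isUnit]
    _ = P.hHat (b * k * (Ring.inverse k * (Ring.inverse P.g * P.W.S a) * Ring.inverse k)) := by
        rw [P.hHat_mul_comm_of_commute hkk, mul_assoc b k, mul_assoc (Ring.inverse k),
          Ring.mul_inverse_cancel_left _ _ hki, ← mul_assoc b]
        simp only [mul_assoc]
    _ = P.hHat (Ring.inverse P.gL * Ring.inverse P.gL * (P.W.S a * b)) := by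
        rw [P.hHat_modular, ← hk, mul_assoc, Ring.inverse_mul_cancel_left _ _ hki, hli']
        simp only [mul_assoc]

/-- `ȷ` is central. -/
theorem jayEl_comm (x : A) : x * P.jayEl = P.jayEl * x := by
  have h₁ (t : A ⊗[ℂ] A) : P.hHat (Ring.inverse P.gL * Ring.inverse P.gL * P.W.S.symm
      (LinearMap.mul' ℂ A (TensorProduct.map LinearMap.id P.W.S.toLinearMap t))) =
      P.hHat (Ring.inverse P.gL * Ring.inverse P.gL *
      (LinearMap.mul' ℂ A (TensorProduct.map P.W.S.toLinearMap LinearMap.id t))) := by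
    induction t with
    | zero => simp
    | add x y hx hy => simp only [map_add, mul_add, hx, hy]
    | tmul a b => simpa using P.hHat_S_symm_swap a b
  have h₂ : (P.hHat ∘ₗ LinearMap.mulLeft ℂ (Ring.inverse P.gL * Ring.inverse P.gL)) ∘ₗ P.W.εR =
      (P.hHat ∘ₗ LinearMap.mulLeft ℂ (Ring.inverse P.gL * Ring.inverse P.gL)) ∘ₗ
        (P.W.S.symm.toLinearMap ∘ₗ P.W.εL) :=
    LinearMap.ext fun y => (h₁ (P.W.Δ y)).symm
  rw [jayEl_eq, ← lapp_one_tmul_mul, ← map_εR_id_Δ, ← lapp_mul_one_tmul, ← map_S_symm_εL_id_Δ,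
    lapp_map, lapp_map, h₂]

theorem inverse_gL_star : star (Ring.inverse P.gL) = Ring.inverse P.gL := by
  apply P.gL_unit.mul_right_cancel
  rw [Ring.inverse_mul_cancel _ P.gL_unit]
  nth_rw 2 [← P.gL_pos.star_eq]
  rw [← star_mul, Ring.mul_inverse_cancel _ P.gL_unit, star_one]

/-- `ȷ` is invertible. -/
theorem jayEl_isUnit : IsUnit P.jayEl := by
  let f : P.W.rightSubspace →ₗ[ℂ] P.W.rightSubspace :=
    (LinearMap.mulRight ℂ P.jayEl).restrict fun r hr => IsRight.mul hr P.jayEl_isRight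
  have hf : Function.Injective f := by
    rw [injective_iff_map_eq_zero]
    rintro ⟨q, hq : P.W.IsRight q⟩ hfq
    have hqj : q * P.jayEl = 0 := congrArg Subtype.val hfq
    have hqs := hq.star_right
    set li := Ring.inverse P.gL with hli
    have h₁ : lapp P.hHat (P.W.Δ (q * (li * li) * star q)) = 0 := by
      rw [P.W.Δ_mul, hqs.right, ← mul_assoc, Δ_mul_Δ_one, hq.Δ_mul_left, lapp_mul_one_tmul,
        lapp_one_tmul_mul]
      change q * P.jayEl * star q = 0
      rw [hqj, zero_mul]
    have h₂ : P.hHat (star (li * star q) * (li * star q)) = 0 := by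
      rw [star_mul, star_star, P.inverse_gL_star, ← hli, ← ε_lapp_Δ (W := P.W)]
      have e : q * li * (li * star q) = q * (li * li) * star q := by simp only [mul_assoc]
      rw [e, h₁, map_zero]
    have h₃ := P.eq_zero_of_hHat_star_mul_self h₂
    have h₄ : star q = 0 := by
      rw [← Ring.mul_inverse_cancel_left P.gL (star q) P.gL_unit, ← hli, h₃, mul_zero]
    exact Subtype.ext (star_eq_zero.mp h₄)
  have h1 : P.W.IsRight 1 := by
    constructor <;> rw [← Algebra.TensorProduct.one_def] <;> simp
  obtain ⟨⟨q, hq⟩, hfq⟩ := LinearMap.injective_iff_surjective.mp hf ⟨1, h1⟩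
  have hqj : q * P.jayEl = 1 := congrArg Subtype.val hfq
  exact ⟨⟨P.jayEl, q, by rw [← P.jayEl_comm, hqj], hqj⟩, rfl⟩

end HaarPkg

namespace HaarPkg

open WeakHopfData

variable (P : HaarPkg A)

theorem sqrt_g_mul_self : P.sqrt P.g * P.sqrt P.g = P.g := P.sqrt_mul_self _ P.g_pos

theorem sqrt_g_isUnit : IsUnit (P.sqrt P.g) := by
  have h : IsUnit (P.sqrt P.g ^ 2) := by rw [sq, sqrt_g_mul_self]; exact P.g_isUnit
  exact (isUnit_pow_iff two_ne_zero).mp h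

theorem sqrt_g_mem_adjoin : P.sqrt P.g ∈ Algebra.adjoin ℂ {P.g} := by
  have h := (P.sqrt_pos P.g P.g_pos).mem_adjoin_mul_self
  rwa [P.sqrt_g_mul_self] at h

theorem commute_sqrt_g {c : A} (hc : Commute c P.g) : Commute c (P.sqrt P.g) := by
  have h := P.sqrt_g_mem_adjoin
  generalize P.sqrt P.g = s at h
  induction h using Algebra.adjoin_induction with
  | mem x hx => rw [Set.mem_singleton_iff.mp hx]; exact hc
  | algebraMap r => exact (Algebra.commutes r c).symm
  | add x y _ _ hx hy => exact hx.add_right hy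
  | mul x y _ _ hx hy => exact hx.mul_right hy

theorem commute_gL_mul_gR_sqrt_g : Commute (P.gL * P.gR) (P.sqrt P.g) :=
  P.commute_sqrt_g (P.commute_gL_g.mul_left P.commute_gR_g)

theorem commute_inverse_gL_inverse_gR :
    Commute (Ring.inverse P.gL) (Ring.inverse P.gR) :=
  P.inverse_gL_isLeft.commute P.inverse_gR_isRight

theorem inverse_gR_mul_inverse_g : Ring.inverse P.gR * Ring.inverse P.g = Ring.inverse P.gL := by
  apply P.gL_unit.mul_left_cancel
  nth_rw 1 [← P.g_mul_gR]
  rw [mul_assoc, Ring.mul_inverse_cancel_left _ _ P.gR_unit, Ring.mul_inverse_cancel _ P.g_isUnit,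
    Ring.mul_inverse_cancel _ P.gL_unit]

theorem inverse_gL_mul_g : Ring.inverse P.gL * P.g = Ring.inverse P.gR :=
  Ring.inverse_mul_cancel_left _ _ P.gL_unit

theorem inverse_jayEl_comm (x : A) : Commute x (Ring.inverse P.jayEl) :=
  commute_ringInverse (P.jayEl_comm x) P.jayEl_isUnit

theorem Δ_one_inverse_jayEl : (1 ⊗ₜ[ℂ] Ring.inverse P.jayEl) * P.W.Δ 1 =
    (Ring.inverse P.jayEl ⊗ₜ[ℂ] 1) * P.W.Δ 1 := by
  have h₁ := (P.jayEl_isLeft.of_mul_eq_one (Ring.mul_inverse_cancel _ P.jayEl_isUnit)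
    (Ring.inverse_mul_cancel _ P.jayEl_isUnit)).left
  have h₂ := (P.jayEl_isRight.of_mul_eq_one (Ring.mul_inverse_cancel _ P.jayEl_isUnit)
    (Ring.inverse_mul_cancel _ P.jayEl_isUnit)).left
  exact h₂.symm.trans h₁

theorem ω_apply (z : A) : P.ω z = P.hHat (Ring.inverse P.jayEl *
    (Ring.inverse P.gL * Ring.inverse P.gR) * z) := rfl

theorem ω_sqrt_mul_mul_sqrt (z : A) : P.ω (P.sqrt P.g * z * P.sqrt P.g) =
    P.hHat (Ring.inverse P.jayEl * (Ring.inverse P.gR * Ring.inverse P.gR) * z) := by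
  have hsL : Commute (P.sqrt P.g) (Ring.inverse P.gL) :=
    commute_ringInverse (P.commute_sqrt_g P.commute_gL_g).symm P.gL_unit
  have hsR : Commute (P.sqrt P.g) (Ring.inverse P.gR) :=
    commute_ringInverse (P.commute_sqrt_g P.commute_gR_g).symm P.gR_unit
  have hc : Commute (P.sqrt P.g)
      (Ring.inverse P.jayEl * (Ring.inverse P.gL * Ring.inverse P.gR)) :=
    (P.inverse_jayEl_comm _).mul_right (hsL.mul_right hsR)
  rw [ω_apply, ← mul_assoc,
    ← P.hHat_mul_comm_of_commute P.commute_gL_mul_gR_sqrt_g.symm, ← mul_assoc, ← mul_assoc,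
    hc.eq, mul_assoc _ (P.sqrt P.g) z, mul_assoc _ (P.sqrt P.g), ← mul_assoc (P.sqrt P.g),
    sqrt_g_mul_self, P.commute_inverse_gL_inverse_gR.eq,
    ← mul_assoc, mul_assoc (Ring.inverse P.jayEl), mul_assoc (Ring.inverse P.gR),
    inverse_gL_mul_g]

theorem ω_inverse_g_mul (z : A) : P.ω (Ring.inverse P.g * z) =
    P.hHat (Ring.inverse P.jayEl * (Ring.inverse P.gL * Ring.inverse P.gL) * z) := by
  rw [ω_apply, ← mul_assoc, mul_assoc (Ring.inverse P.jayEl), mul_assoc (Ring.inverse P.gL),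
    inverse_gR_mul_inverse_g]

theorem contractB_comp_Δ : P.contractB ∘ₗ P.W.Δ = (P.hHat ∘ₗ LinearMap.mulLeft ℂ
    (Ring.inverse P.jayEl * (Ring.inverse P.gR * Ring.inverse P.gR))) ∘ₗ P.W.εL := by
  have h (t : A ⊗[ℂ] A) : P.contractB t = P.ω (P.sqrt P.g *
      LinearMap.mul' ℂ A (TensorProduct.map LinearMap.id P.W.S.toLinearMap t) * P.sqrt P.g) := by
    induction t with
    | zero => simp
    | add x y hx hy => simp only [map_add, mul_add, add_mul, hx, hy]
    | tmul a b =>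
      simp only [contractB, Jlin, LinearMap.comp_apply, TensorProduct.map_tmul,
        LinearMap.mul'_apply, LinearMap.mulRight_apply, LinearMap.mulLeft_apply,
        LinearMap.id_apply, LinearEquiv.coe_coe]
      rw [mul_assoc (P.sqrt P.g * a), mul_assoc (Ring.inverse _),
        Ring.mul_inverse_cancel_left _ _ P.sqrt_g_isUnit]
      simp only [mul_assoc]
  ext y
  exact (h (P.W.Δ y)).trans (P.ω_sqrt_mul_mul_sqrt _)

theorem contractC_comp_Δ : P.contractC ∘ₗ P.W.Δ = (P.hHat ∘ₗ LinearMap.mulLeft ℂ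
    (Ring.inverse P.jayEl * (Ring.inverse P.gL * Ring.inverse P.gL))) ∘ₗ P.W.εR := by
  have hs : Ring.inverse (P.sqrt P.g) * Ring.inverse (P.sqrt P.g) = Ring.inverse P.g := by
    rw [← Ring.mul_inverse_rev' (Commute.refl _), sqrt_g_mul_self]
  have h (t : A ⊗[ℂ] A) : P.contractC t = P.ω (Ring.inverse P.g *
      LinearMap.mul' ℂ A (TensorProduct.map P.W.S.toLinearMap LinearMap.id t)) := by
    induction t with
    | zero => simp
    | add x y hx hy => simp only [map_add, mul_add, hx, hy]
    | tmul a b =>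
      simp only [contractC, Jlin, LinearMap.comp_apply, TensorProduct.map_tmul,
        LinearMap.mul'_apply, LinearMap.mulRight_apply, LinearMap.mulLeft_apply,
        LinearMap.id_apply, LinearEquiv.coe_coe]
      rw [← mul_assoc, Ring.mul_inverse_cancel_right _ _ P.sqrt_g_isUnit, ← mul_assoc, hs,
        mul_assoc]
  ext y
  exact (h (P.W.Δ y)).trans (P.ω_inverse_g_mul _)

theorem rapp_hHat_inverse_gR_sq : rapp (P.hHat ∘ₗ
    LinearMap.mulLeft ℂ (Ring.inverse P.gR * Ring.inverse P.gR)) (P.W.Δ 1) = P.jayEl := by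
  have hS : Ring.inverse P.gR = P.W.S (Ring.inverse P.gL) := by
    apply P.gR_unit.mul_right_cancel
    rw [Ring.inverse_mul_cancel _ P.gR_unit, P.gR_S, ← P.W.S_antimul,
      Ring.mul_inverse_cancel _ P.gL_unit, P.W.S_one]
  have h (t : A ⊗[ℂ] A) : rapp P.hHat (TensorProduct.comm ℂ A A
      (TensorProduct.map P.W.S.toLinearMap P.W.S.toLinearMap t)) = P.W.S (lapp P.hHat t) := by
    induction t with
    | zero => simp
    | add x y hx hy => simp only [map_add, hx, hy]
    | tmul a b => simp [P.hHat_S]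
  rw [← rapp_one_tmul_mul, ← (P.inverse_gR_isRight.mul P.inverse_gR_isRight).left, hS,
    ← P.W.S_antimul, P.W.S_anticomul, h]
  exact P.S_jayEl

end HaarPkg

/-- **Closing identities.**  Writing `Δ⁽²⁾ x = x₍₁₎ ⊗ x₍₂₎ ⊗ x₍₃₎`:
`⟨ω, g^{1/2} x₍₂₎ g^{1/2} J(x₍₃₎)⟩ x₍₁₎ = x` and
`⟨ω, g^{-1/2} J(x₍₁₎) g^{-1/2} x₍₂₎⟩ x₍₃₎ = x`. -/
theorem HaarPkg.closing_identities (P : HaarPkg A) (x : A) :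
    (TensorProduct.rid ℂ A) ((TensorProduct.map LinearMap.id P.contractB)
        ((TensorProduct.map LinearMap.id P.W.Δ) (P.W.Δ x))) = x ∧
    (TensorProduct.lid ℂ A) ((TensorProduct.map P.contractC LinearMap.id)
        ((TensorProduct.map P.W.Δ LinearMap.id) (P.W.Δ x))) = x := by
  have hu : Ring.inverse P.jayEl * P.jayEl = 1 := Ring.inverse_mul_cancel _ P.jayEl_isUnit
  have hω (c : A) : LinearMap.mulLeft ℂ (Ring.inverse P.jayEl * c) =
      LinearMap.mulLeft ℂ c ∘ₗ LinearMap.mulLeft ℂ (Ring.inverse P.jayEl) := by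
    rw [← (P.inverse_jayEl_comm c).eq, LinearMap.mulLeft_mul]
  constructor
  · have h : rapp (P.contractB ∘ₗ P.W.Δ) (P.W.Δ x) = x := by
      rw [contractB_comp_Δ]
      rw [← LinearMap.id_apply (R := ℂ) (rapp _ _), ← rapp_map, WeakHopfData.map_id_εL_Δ,
        rapp_mul_tmul_one, hω, ← LinearMap.comp_assoc, ← rapp_one_tmul_mul,
        Δ_one_inverse_jayEl, rapp_tmul_one_mul, rapp_hHat_inverse_gR_sq, hu, one_mul]
    rw [← LinearMap.comp_apply (TensorProduct.map _ _), ← TensorProduct.map_comp]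
    exact h
  · have h : lapp (P.contractC ∘ₗ P.W.Δ) (P.W.Δ x) = x := by
      rw [contractC_comp_Δ, ← LinearMap.id_apply (R := ℂ) (lapp _ _), ← lapp_map,
        WeakHopfData.map_εR_id_Δ,
        lapp_one_tmul_mul, hω, ← LinearMap.comp_assoc, ← lapp_tmul_one_mul,
        ← Δ_one_inverse_jayEl, lapp_one_tmul_mul, ← jayEl_eq, hu, mul_one]
    rw [← LinearMap.comp_apply (TensorProduct.map _ _), ← TensorProduct.map_comp]
    exact h

end Stmt16

end
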